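/- Let H be a strictly balanced graph with V(H) = {h_1,…,h_v}, let (G,H) be a strictly balanced pair with H ⊂ G, and suppose ρ(H) = ρ(G,H) = 1/α. For an ordered tuple w = (x_{i_1},…,x_{i_v}) of distinct vertices of {1,…,n}, let A_w be the event that some spanning subgraph of the restriction of G(n, n^{−α}) to the vertices of w is isomorphic to H via the map sending x_{i_j} to h_j for each j. Then there exists a strictly increasing sequence (n_i) of positive integers such that the probability of the event "G(n_i, n_i^{−α}) contains at least one copy of H, and for every ordered v-tuple w of distinct vertices either A_w fails or w has no (G,(h_1,…,h_v))-extension in G(n_i, n_i^{−α})" converges as i → ∞ to a limit that is strictly greater than 0 and strictly less than 1. -/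

import Mathlib

open Filter Topology FirstOrder

namespace RandomGraphSpectra

/-- The quantifier depth of a first-order (bounded) formula. -/
def qDepth {L : FirstOrder.Language} {α : Type*} :
    ∀ {n : ℕ}, L.BoundedFormula α n → ℕ
  | _, .falsum => 0
  | _, .equal _ _ => 0
  | _, .rel _ _ => 0
  | _, .imp f g => max (qDepth f) (qDepth g)
  | _, .all f => qDepth f + 1

/-- A simple graph satisfies a first-order sentence in the language of graphs. -/
def GraphSat {V : Type*} (G : SimpleGraph V) (φ : FirstOrder.Language.graph.Sentence) : Prop :=
  @FirstOrder.Language.Sentence.Realize FirstOrder.Language.graph V G.structure φ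

/-- The number of edges of a simple graph. -/
noncomputable def edgeCount {V : Type*} (G : SimpleGraph V) : ℕ := Nat.card G.edgeSet

/-- The probability that `G(n,p)` equals a fixed graph `G` on `{1,…,n}`. -/
noncomputable def weight (n : ℕ) (p : ℝ) (G : SimpleGraph (Fin n)) : ℝ :=
  p ^ edgeCount G * (1 - p) ^ (n.choose 2 - edgeCount G)

open Classical in
/-- The probability that the Erdős–Rényi random graph `G(n,p)` satisfies a predicate `P`. -/
noncomputable def probPred (n : ℕ) (p : ℝ) (P : SimpleGraph (Fin n) → Prop) : ℝ :=
  ∑ᶠ G : SimpleGraph (Fin n), if P G then weight n p G else 0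

/-- The probability that `G(n,p)` satisfies a first-order sentence. -/
noncomputable def probSat (n : ℕ) (p : ℝ) (φ : FirstOrder.Language.graph.Sentence) : ℝ :=
  probPred n p (fun G => GraphSat G φ)

open Classical in
/-- The probability that the pair of independent random graphs `G(n,p), G(m,q)`
satisfies a predicate `P`. -/
noncomputable def probPred2 (n m : ℕ) (p q : ℝ)
    (P : SimpleGraph (Fin n) → SimpleGraph (Fin m) → Prop) : ℝ :=
  ∑ᶠ G : SimpleGraph (Fin n), ∑ᶠ H : SimpleGraph (Fin m),
    if P G H then weight n p G * weight m q H else 0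

/-- The spectrum `S_k^1`: the set of `α ∈ (0,1)` such that for some first-order sentence `φ`
of quantifier depth at most `k`, with `p(n) = n^{-α}`, the probability that `G(n,p(n)) ⊨ φ`
does not tend to `0` and does not tend to `1`. -/
def S1 (k : ℕ) : Set ℝ :=
  {α | α ∈ Set.Ioo (0 : ℝ) 1 ∧ ∃ φ : FirstOrder.Language.graph.Sentence, qDepth φ ≤ k ∧
    ¬(Tendsto (fun n : ℕ => probSat n ((n : ℝ) ^ (-α)) φ) atTop (nhds 0) ∨
      Tendsto (fun n : ℕ => probSat n ((n : ℝ) ^ (-α)) φ) atTop (nhds 1))}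

/-- The spectrum `S_k^2`. -/
def S2 (k : ℕ) : Set ℝ :=
  {α | α ∈ Set.Ioo (0 : ℝ) 1 ∧ ∃ φ : FirstOrder.Language.graph.Sentence, qDepth φ ≤ k ∧
    ¬∃ δ : ℝ, (δ = 0 ∨ δ = 1) ∧ ∃ ε : ℝ, 0 < ε ∧ ∀ p : ℕ → ℝ,
      (∀ n : ℕ, 1 ≤ n → (n : ℝ) ^ (-α - ε) < p n ∧ p n < (n : ℝ) ^ (-α + ε)) →
      Tendsto (fun n : ℕ => probSat n (p n) φ) atTop (nhds δ)}

/-- `G(n, p(n))` obeys the zero-one `k`-law. -/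
def ZeroOneKLaw (k : ℕ) (p : ℕ → ℝ) : Prop :=
  ∀ φ : FirstOrder.Language.graph.Sentence, qDepth φ ≤ k →
    Tendsto (fun n : ℕ => probSat n (p n) φ) atTop (nhds 0) ∨
    Tendsto (fun n : ℕ => probSat n (p n) φ) atTop (nhds 1)

/-- The density `ρ(G) = e(G)/v(G)` of a graph. -/
noncomputable def density {V : Type*} (G : SimpleGraph V) : ℝ :=
  (Nat.card G.edgeSet : ℝ) / (Nat.card V : ℝ)

/-- A graph is strictly balanced if every proper subgraph with at least one vertex has
strictly smaller density. -/
def StrictlyBalanced {V : Type*} (G : SimpleGraph V) : Prop :=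
  ∀ H : G.Subgraph, H ≠ ⊤ → H.verts.Nonempty → density H.coe < density G

/-- `ρ^max(G)`: the maximum density of a subgraph of `G` with at least one vertex. -/
noncomputable def maxDensity {V : Type*} (G : SimpleGraph V) : ℝ :=
  sSup {x : ℝ | ∃ H : G.Subgraph, H.verts.Nonempty ∧ x = density H.coe}

/-- The relative density `ρ(K,H) = e(K,H)/v(K,H)` of a pair of nested subgraphs. -/
noncomputable def pairDensity {V : Type*} {G : SimpleGraph V} (K H : G.Subgraph) : ℝ :=
  ((Nat.card K.edgeSet : ℝ) - (Nat.card H.edgeSet : ℝ)) /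
    ((Nat.card K.verts : ℝ) - (Nat.card H.verts : ℝ))

/-- `ρ^max(G,H)` where the ambient graph `G` corresponds to the top subgraph. -/
noncomputable def maxPairDensity {V : Type*} {G : SimpleGraph V} (H : G.Subgraph) : ℝ :=
  sSup {x : ℝ | ∃ K : G.Subgraph, H < K ∧ x = pairDensity K H}

/-- `f_α(K,H) = v(K,H) - α·e(K,H)`. -/
noncomputable def fAlpha (α : ℝ) {V : Type*} {G : SimpleGraph V} (K H : G.Subgraph) : ℝ :=
  ((Nat.card K.verts : ℝ) - (Nat.card H.verts : ℝ)) -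
    α * ((Nat.card K.edgeSet : ℝ) - (Nat.card H.edgeSet : ℝ))

/-- The pair `(G,H)` is `α`-safe: `f_α(S,H) > 0` for every `S` with `H ⊂ S ⊆ G`. -/
def AlphaSafe (α : ℝ) {V : Type*} (G : SimpleGraph V) (H : G.Subgraph) : Prop :=
  ∀ S : G.Subgraph, H < S → 0 < fAlpha α S H

/-- The pair `(G,H)` is strictly balanced: `ρ(G,H) > ρ(K,H)` for every `H ⊂ K ⊂ G`. -/
def StrictlyBalancedPair {V : Type*} (G : SimpleGraph V) (H : G.Subgraph) : Prop :=
  ∀ K : G.Subgraph, H < K → K ≠ ⊤ → pairDensity K H < pairDensity (⊤ : G.Subgraph) H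

/-- The set `E(K) \ (E(H) ∪ E(K∖H))` is non-empty: `K` has an edge, not an edge of `H`,
with at least one endpoint in `V(H)`. -/
def TouchesRoots {V : Type*} {G : SimpleGraph V} (H K : G.Subgraph) : Prop :=
  ∃ u v : V, K.Adj u v ∧ ¬H.Adj u v ∧ (u ∈ H.verts ∨ v ∈ H.verts)

/-- `e^min(G,H)` (`G` being the top subgraph). -/
noncomputable def eMin {V : Type*} {G : SimpleGraph V} (H : G.Subgraph) : ℕ :=
  sInf {e : ℕ | ∃ K : G.Subgraph, H < K ∧ TouchesRoots H K ∧
    pairDensity K H = maxPairDensity H ∧ e = Nat.card K.edgeSet - Nat.card H.edgeSet}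

/-- `f` realizes a `(G,(r 0,…,r (m-1)))`-extension of the tuple `x` in `Γ`: an injective copy
of the vertex set of `G` sending the roots to `x` and containing all edges of `E(G)∖E(H)`
as edges outside the root-induced subgraph. -/
def IsExtension {W V : Type*} (Gp : SimpleGraph W) (H : Gp.Subgraph) {m : ℕ}
    (r : Fin m → W) (Γ : SimpleGraph V) (x : Fin m → V) (f : W → V) : Prop :=
  Function.Injective f ∧ (∀ j : Fin m, f (r j) = x j) ∧
    ∀ u v : W, Gp.Adj u v → ¬H.Adj u v →
      Γ.Adj (f u) (f v) ∧ ¬(u ∈ H.verts ∧ v ∈ H.verts)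

/-- Strict extension: the implication above is an equivalence. -/
def IsStrictExtension {W V : Type*} (Gp : SimpleGraph W) (H : Gp.Subgraph) {m : ℕ}
    (r : Fin m → W) (Γ : SimpleGraph V) (x : Fin m → V) (f : W → V) : Prop :=
  Function.Injective f ∧ (∀ j : Fin m, f (r j) = x j) ∧
    ∀ u v : W, (Gp.Adj u v ∧ ¬H.Adj u v) ↔
      (Γ.Adj (f u) (f v) ∧ ¬(u ∈ H.verts ∧ v ∈ H.verts))

/-- The pair of subgraphs of `Γ` with vertex sets `B ⊆ A` is `(K,T)`-maximal in `Γ`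
(where `T ⊂ K` has roots enumerated by `s`). -/
def PairMaximal {U V : Type*} (Kp : SimpleGraph U) (T : Kp.Subgraph) {t : ℕ}
    (s : Fin t → U) (Γ : SimpleGraph V) (A B : Set V) : Prop :=
  ∀ tup : Fin t → V, Function.Injective tup → (∀ i, tup i ∈ A) → (∃ i, tup i ∉ B) →
    ¬∃ f : U → V, IsStrictExtension Kp T s Γ tup f ∧
      (∀ u : U, f u ∈ A → f u ∈ Set.range tup) ∧
      (∀ u : U, f u ∉ Set.range tup → ∀ a ∈ A, a ∉ Set.range tup → ¬Γ.Adj (f u) a)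

/-- The subgraph of `Γ` with vertex set `A` is `(K,T)`-maximal in `Γ`. -/
def GraphMaximal {U V : Type*} (Kp : SimpleGraph U) (T : Kp.Subgraph) {t : ℕ}
    (s : Fin t → U) (Γ : SimpleGraph V) (A : Set V) : Prop :=
  ∀ tup : Fin t → V, Function.Injective tup → (∀ i, tup i ∈ A) →
    ¬∃ f : U → V, IsStrictExtension Kp T s Γ tup f ∧
      (∀ u : U, f u ∈ A → f u ∈ Set.range tup) ∧
      (∀ u : U, f u ∉ Set.range tup → ∀ a ∈ A, a ∉ Set.range tup → ¬Γ.Adj (f u) a)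

/-- `Γ` contains a copy of `Gp`. -/
def ContainsCopy {W V : Type*} (Gp : SimpleGraph W) (Γ : SimpleGraph V) : Prop :=
  ∃ f : W → V, Function.Injective f ∧ ∀ u v : W, Gp.Adj u v → Γ.Adj (f u) (f v)

/-- The number of copies of `Gp` in `Γ`: subgraphs of `Γ` isomorphic to `Gp`. -/
noncomputable def numCopies {W V : Type*} (Gp : SimpleGraph W) (Γ : SimpleGraph V) : ℕ :=
  Nat.card {H : Γ.Subgraph // Nonempty (Gp ≃g H.coe)}

/-- The matched tuples of chosen vertices induce a partial isomorphism. -/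
def PartialIso {V W : Type*} (G : SimpleGraph V) (H : SimpleGraph W)
    (xs : List V) (ys : List W) : Prop :=
  ∃ h : xs.length = ys.length,
    ∀ j k : Fin xs.length,
      (xs.get j = xs.get k ↔ ys.get (Fin.cast h j) = ys.get (Fin.cast h k)) ∧
      (G.Adj (xs.get j) (xs.get k) ↔ H.Adj (ys.get (Fin.cast h j)) (ys.get (Fin.cast h k)))

/-- Duplicator has a winning strategy in the remaining `i` rounds of the Ehrenfeucht game
on `(G,H)` from the position given by the already chosen vertices `xs`, `ys`. -/
def DuplicatorWinsFrom {V W : Type*} (G : SimpleGraph V) (H : SimpleGraph W) :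
    ℕ → List V → List W → Prop
  | 0, xs, ys => PartialIso G H xs ys
  | (i + 1), xs, ys =>
      (∀ x : V, ∃ y : W, DuplicatorWinsFrom G H i (x :: xs) (y :: ys)) ∧
      (∀ y : W, ∃ x : V, DuplicatorWinsFrom G H i (x :: xs) (y :: ys))

/-- Duplicator has a winning strategy in the Ehrenfeucht game `EHR(G,H,i)`. -/
def DuplicatorWins {V W : Type*} (G : SimpleGraph V) (H : SimpleGraph W) (i : ℕ) : Prop :=
  DuplicatorWinsFrom G H i [] []

end RandomGraphSpectra

namespace RandomGraphSpectra

/-- The class `𝒮` of graphs from Section "Properties which imply the existence of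
Duplicator's winning strategy" (properties 1)–3)). -/
def GoodGraph (k b : ℕ) (α : ℝ) {V : Type*} (Γ : SimpleGraph V) : Prop :=
  -- 1) no strictly balanced subgraph with at most `2^{2k}·b` vertices and density `> 1/α`
  (∀ A : Γ.Subgraph, Nat.card A.verts ≤ 2 ^ (2 * k) * b → StrictlyBalanced A.coe →
      density A.coe ≤ 1 / α) ∧
  -- 2) strict extensions of α-safe pairs which are `(K₁,K₂)`-maximal
  (∀ (l h : ℕ) (H₁ : SimpleGraph (Fin l)) (H₂ : H₁.Subgraph) (r : Fin h → Fin l),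
      Function.Injective r → Set.range r = H₂.verts →
      l ≤ 2 ^ (2 * k) * b + k * 2 ^ k → AlphaSafe α H₁ H₂ →
      ∀ x : Fin h → V, Function.Injective x →
        ∃ f : Fin l → V, IsStrictExtension H₁ H₂ r Γ x f ∧
          ∀ (u t : ℕ) (K₁ : SimpleGraph (Fin u)) (K₂ : K₁.Subgraph) (s : Fin t → Fin u),
            Function.Injective s → Set.range s = K₂.verts →
            u ≤ 2 ^ k → Nat.card K₂.verts ≤ 2 → fAlpha α (⊤ : K₁.Subgraph) K₂ < 0 →
            PairMaximal K₁ K₂ s Γ (Set.range f) (Set.range x)) ∧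
  -- 3) maximal copies of sparse strictly balanced graphs
  (∀ (w : ℕ) (Hp : SimpleGraph (Fin w)), w ≤ 2 ^ (2 * k) * b → StrictlyBalanced Hp →
      density Hp < 1 / α →
      ∃ f : Fin w → V, Function.Injective f ∧
        (∀ u v : Fin w, Hp.Adj u v → Γ.Adj (f u) (f v)) ∧
        ∀ (u t : ℕ) (K₁ : SimpleGraph (Fin u)) (K₂ : K₁.Subgraph) (s : Fin t → Fin u),
          Function.Injective s → Set.range s = K₂.verts →
          u ≤ 2 ^ k → Nat.card K₂.verts ≤ 2 → fAlpha α (⊤ : K₁.Subgraph) K₂ < 0 →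
          GraphMaximal K₁ K₂ s Γ (Set.range f))

end RandomGraphSpectra

namespace RandomGraphSpectra

open Filter Topology


open Classical in
/-- Indicator of a proposition. -/
noncomputable def ind (P : Prop) : ℝ := if P then 1 else 0

lemma ind_nonneg (P : Prop) : 0 ≤ ind P := by unfold ind; split_ifs <;> norm_num

lemma ind_le_one (P : Prop) : ind P ≤ 1 := by unfold ind; split_ifs <;> norm_num

lemma ind_true {P : Prop} (h : P) : ind P = 1 := by simp [ind, h]

lemma ind_false {P : Prop} (h : ¬P) : ind P = 0 := by simp [ind, h]

lemma ind_mono {P Q : Prop} (h : P → Q) : ind P ≤ ind Q := by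
  by_cases hP : P
  · rw [ind_true hP, ind_true (h hP)]
  · rw [ind_false hP]; exact ind_nonneg _

lemma ind_mul (P Q : Prop) : ind P * ind Q = ind (P ∧ Q) := by
  by_cases hP : P <;> by_cases hQ : Q <;> simp [ind, hP, hQ]

/-- Expectation in `G(n,p)`. -/
noncomputable def Ex (n : ℕ) (p : ℝ) (X : SimpleGraph (Fin n) → ℝ) : ℝ :=
  ∑ Γ : SimpleGraph (Fin n), weight n p Γ * X Γ

lemma probPred_eq (n : ℕ) (p : ℝ) (P : SimpleGraph (Fin n) → Prop) :
    probPred n p P = Ex n p (fun Γ => ind (P Γ)) := by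
  classical
  unfold probPred Ex
  rw [finsum_eq_sum_of_fintype]
  refine Finset.sum_congr rfl fun Γ _ => ?_
  by_cases h : P Γ <;> simp [ind, h]

lemma weight_nonneg {n : ℕ} {p : ℝ} (h0 : 0 ≤ p) (h1 : p ≤ 1) (Γ : SimpleGraph (Fin n)) :
    0 ≤ weight n p Γ := by
  unfold weight
  have : 0 ≤ 1 - p := by linarith
  positivity

lemma Ex_mono {n : ℕ} {p : ℝ} (h0 : 0 ≤ p) (h1 : p ≤ 1) {X Y : SimpleGraph (Fin n) → ℝ}
    (h : ∀ Γ, X Γ ≤ Y Γ) : Ex n p X ≤ Ex n p Y :=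
  Finset.sum_le_sum fun Γ _ => mul_le_mul_of_nonneg_left (h Γ) (weight_nonneg h0 h1 Γ)

lemma edgeCount_eq {V : Type*} [Finite V] (G : SimpleGraph V) :
    edgeCount G = G.edgeSet.ncard := rfl

lemma edgeCount_le {n : ℕ} (G : SimpleGraph (Fin n)) : edgeCount G ≤ n.choose 2 := by
  classical
  have h := SimpleGraph.card_edgeFinset_le_card_choose_two (G := G)
  rw [Fintype.card_fin] at h
  rwa [edgeCount_eq, ← SimpleGraph.coe_edgeFinset, Set.ncard_coe_finset]

lemma edgeCount_top {n : ℕ} : edgeCount (⊤ : SimpleGraph (Fin n)) = n.choose 2 := by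
  classical
  have h := SimpleGraph.card_edgeFinset_top_eq_card_choose_two (V := Fin n)
  rw [Fintype.card_fin] at h
  rwa [edgeCount_eq, ← SimpleGraph.coe_edgeFinset, Set.ncard_coe_finset]

lemma edgeCount_mono {V : Type*} [Finite V] {A B : SimpleGraph V} (h : A ≤ B) :
    edgeCount A ≤ edgeCount B :=
  Set.ncard_le_ncard (SimpleGraph.edgeSet_mono h) (Set.toFinite _)

lemma edgeCount_sup_inf {V : Type*} [Finite V] (A B : SimpleGraph V) :
    edgeCount (A ⊔ B) + edgeCount (A ⊓ B) = edgeCount A + edgeCount B := by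
  rw [edgeCount_eq, edgeCount_eq, edgeCount_eq, edgeCount_eq, SimpleGraph.edgeSet_sup,
    SimpleGraph.edgeSet_inf]
  exact Set.ncard_union_add_ncard_inter _ _ (Set.toFinite _) (Set.toFinite _)

lemma weight_mul {n : ℕ} {p : ℝ} (A B : SimpleGraph (Fin n)) :
    weight n p A * weight n p B = weight n p (A ⊓ B) * weight n p (A ⊔ B) := by
  unfold weight
  have h := edgeCount_sup_inf A B
  have hA := edgeCount_le A
  have hB := edgeCount_le B
  have h1 := edgeCount_le (A ⊓ B)
  have h2 := edgeCount_le (A ⊔ B)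
  rw [mul_mul_mul_comm (p ^ edgeCount A), mul_mul_mul_comm (p ^ edgeCount (A ⊓ B)), ← pow_add, ← pow_add, ← pow_add, ← pow_add]
  congr 2 <;> omega

lemma Ex_contains (n : ℕ) (p : ℝ) (K : SimpleGraph (Fin n)) :
    Ex n p (fun Γ => ind (K ≤ Γ)) = p ^ edgeCount K := by
  classical
  have hc : ∀ G : SimpleGraph (Fin n), edgeCount G = G.edgeFinset.card := fun G => by
    rw [edgeCount_eq, ← SimpleGraph.coe_edgeFinset, Set.ncard_coe_finset]
  unfold Ex
  have h1 : ∑ Γ : SimpleGraph (Fin n), weight n p Γ * ind (K ≤ Γ) =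
      ∑ Γ : SimpleGraph (Fin n) with K ≤ Γ, weight n p Γ := by
    rw [Finset.sum_filter]
    refine Finset.sum_congr rfl fun Γ _ => ?_
    by_cases h : K ≤ Γ <;> simp [ind, h]
  rw [h1]
  set E := (⊤ : SimpleGraph (Fin n)).edgeFinset with hE
  have hEc : E.card = n.choose 2 := by
    rw [← edgeCount_top, hc]; congr!
  have hKE : K.edgeFinset ⊆ E := SimpleGraph.edgeFinset_mono le_top
  have h2 : ∑ Γ : SimpleGraph (Fin n) with K ≤ Γ, weight n p Γ =
      ∑ t ∈ (E \ K.edgeFinset).powerset,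
        p ^ edgeCount K * (p ^ t.card * (1 - p) ^ ((E \ K.edgeFinset).card - t.card)) := by
    refine Finset.sum_bij' (fun Γ _ => Γ.edgeFinset \ K.edgeFinset)
      (fun t _ => SimpleGraph.fromEdgeSet ((t ∪ K.edgeFinset : Finset _) : Set (Sym2 (Fin n))))
      ?_ ?_ ?_ ?_ ?_
    · intro Γ _
      rw [Finset.mem_powerset]
      exact Finset.sdiff_subset_sdiff (SimpleGraph.edgeFinset_mono le_top) le_rfl
    · intro t _
      simp only [Finset.mem_filter, Finset.mem_univ, true_and]
      intro a b hab
      simp [SimpleGraph.fromEdgeSet_adj, hab, hab.ne]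
    · intro Γ hΓ
      simp only [Finset.mem_filter, Finset.mem_univ, true_and] at hΓ
      ext a b
      have := @hΓ a b
      simp only [Finset.sdiff_union_self_eq_union, Finset.coe_union, SimpleGraph.coe_edgeFinset,
        SimpleGraph.fromEdgeSet_adj, Set.mem_union, SimpleGraph.mem_edgeSet]
      constructor
      · rintro ⟨h | h, _⟩
        exacts [h, this h]
      · exact fun h => ⟨Or.inl h, h.ne⟩
    · intro t ht
      rw [Finset.mem_powerset] at ht
      ext e
      induction e using Sym2.ind with | _ a b =>
      have h3 : s(a,b) ∈ t → a ≠ b ∧ ¬ K.Adj a b := fun h => by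
        have := ht h
        simpa [hE] using this
      simp only [Finset.mem_sdiff, SimpleGraph.mem_edgeFinset, SimpleGraph.mem_edgeSet,
        SimpleGraph.fromEdgeSet_adj, Finset.coe_union, Set.mem_union, Finset.mem_coe]
      constructor
      · rintro ⟨⟨h | h, _⟩, h'⟩
        exacts [h, absurd h h']
      · exact fun h => ⟨⟨Or.inl h, (h3 h).1⟩, (h3 h).2⟩
    · intro Γ hΓ
      simp only [Finset.mem_filter, Finset.mem_univ, true_and] at hΓ
      have hs : K.edgeFinset ⊆ Γ.edgeFinset := SimpleGraph.edgeFinset_mono hΓ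
      have h4 := Finset.card_le_card hs
      have h5 := edgeCount_le Γ
      rw [hc] at h5
      unfold weight
      rw [Finset.card_sdiff_of_subset hs, Finset.card_sdiff_of_subset hKE, hEc, hc, hc,
        ← mul_assoc, ← pow_add]
      congr 2 <;> omega
  rw [h2, ← Finset.mul_sum, Finset.sum_pow_mul_eq_add_pow]
  simp

lemma Ex_one (n : ℕ) (p : ℝ) : Ex n p (fun _ => 1) = 1 := by
  have := Ex_contains n p ⊥
  have h : edgeCount (⊥ : SimpleGraph (Fin n)) = 0 := by simp [edgeCount_eq]
  simpa [h, ind] using this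

lemma Ex_sum {ι : Type*} (s : Finset ι) (n : ℕ) (p : ℝ) (X : ι → SimpleGraph (Fin n) → ℝ) :
    Ex n p (fun Γ => ∑ i ∈ s, X i Γ) = ∑ i ∈ s, Ex n p (X i) := by
  unfold Ex
  simp_rw [Finset.mul_sum]
  exact Finset.sum_comm

/-- Harris/FKG for antitone functions, under conditioning on containing `K`. -/
lemma harris {n : ℕ} {p : ℝ} (h0 : 0 ≤ p) (h1 : p ≤ 1) (K : SimpleGraph (Fin n))
    (f g : SimpleGraph (Fin n) → ℝ) (hf0 : ∀ Γ, 0 ≤ f Γ) (hg0 : ∀ Γ, 0 ≤ g Γ)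
    (hf : Antitone f) (hg : Antitone g) :
    Ex n p (fun Γ => ind (K ≤ Γ) * f Γ) * Ex n p (fun Γ => ind (K ≤ Γ) * g Γ) ≤
      Ex n p (fun Γ => ind (K ≤ Γ)) * Ex n p (fun Γ => ind (K ≤ Γ) * (f Γ * g Γ)) := by
  have := fkg (α := (SimpleGraph (Fin n))ᵒᵈ)
    (fun Γ => f (OrderDual.ofDual Γ)) (fun Γ => g (OrderDual.ofDual Γ))
    (fun Γ => weight n p (OrderDual.ofDual Γ) * ind (K ≤ OrderDual.ofDual Γ))
    (fun Γ => mul_nonneg (weight_nonneg h0 h1 _) (ind_nonneg _))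
    (fun Γ => hf0 _) (fun Γ => hg0 _) (fun a b hab => hf hab) (fun a b hab => hg hab)
    (fun a b => by
      induction a using OrderDual.rec with | _ a =>
      induction b using OrderDual.rec with | _ b =>
      simp only [← toDual_inf, ← toDual_sup, OrderDual.ofDual_toDual]
      by_cases ha : K ≤ a
      · by_cases hb : K ≤ b
        · have e1 : K ≤ a ⊓ b := le_inf ha hb
          have e2 : K ≤ a ⊔ b := le_sup_of_le_left ha
          have : weight n p a * weight n p b = _ := weight_mul a b
          change _ ≤ (weight n p (a ⊔ b) * ind (K ≤ a ⊔ b)) * (weight n p (a ⊓ b) * ind (K ≤ a ⊓ b))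
          rw [ind_true ha, ind_true hb, ind_true e1, ind_true e2]
          linarith
        · rw [ind_false hb]
          simp only [mul_zero]
          exact mul_nonneg (mul_nonneg (weight_nonneg h0 h1 _) (ind_nonneg _))
            (mul_nonneg (weight_nonneg h0 h1 _) (ind_nonneg _))
      · rw [ind_false ha]
        simp only [mul_zero, zero_mul]
        exact mul_nonneg (mul_nonneg (weight_nonneg h0 h1 _) (ind_nonneg _))
          (mul_nonneg (weight_nonneg h0 h1 _) (ind_nonneg _)))
  unfold Ex
  simp only [mul_assoc] at this
  exact this

lemma antitone_not {n : ℕ} (A : SimpleGraph (Fin n)) : Antitone fun Γ => ind (¬ A ≤ Γ) :=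
  fun _ _ h => ind_mono fun h1 h2 => h1 (h2.trans h)

lemma Ex_not {n : ℕ} {p : ℝ} (K A : SimpleGraph (Fin n)) :
    Ex n p (fun Γ => ind (K ≤ Γ) * ind (¬ A ≤ Γ)) =
      p ^ edgeCount K * (1 - p ^ (edgeCount (A ⊔ K) - edgeCount K)) := by
  have h : edgeCount K + (edgeCount (A ⊔ K) - edgeCount K) = edgeCount (A ⊔ K) := by
    have := edgeCount_mono (le_sup_right : K ≤ A ⊔ K)
    omega
  rw [mul_sub, ← pow_add, h, mul_one, ← Ex_contains, ← Ex_contains, Ex, Ex, Ex,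
    ← Finset.sum_sub_distrib]
  refine Finset.sum_congr rfl fun Γ _ => ?_
  rw [← mul_sub]
  congr 1
  by_cases h1 : K ≤ Γ <;> by_cases h2 : A ≤ Γ <;> simp [ind, h1, h2]

lemma harris_multi {n : ℕ} {p : ℝ} (h0 : 0 < p) (h1 : p ≤ 1) (K : SimpleGraph (Fin n))
    {ι : Type*} (s : Finset ι) (A : ι → SimpleGraph (Fin n)) :
    p ^ edgeCount K * ∏ i ∈ s, (1 - p ^ (edgeCount (A i ⊔ K) - edgeCount K)) ≤
      Ex n p (fun Γ => ind (K ≤ Γ) * ∏ i ∈ s, ind (¬ A i ≤ Γ)) := by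
  classical
  induction s using Finset.induction_on with
  | empty => simp [Ex_contains]
  | insert a s ha ih =>
    have hh := harris h0.le h1 K (fun Γ => ind (¬ A a ≤ Γ)) (fun Γ => ∏ i ∈ s, ind (¬ A i ≤ Γ))
      (fun _ => ind_nonneg _) (fun _ => Finset.prod_nonneg fun _ _ => ind_nonneg _)
      (antitone_not _) (fun Γ Γ' h => Finset.prod_le_prod (fun _ _ => ind_nonneg _)
        fun i _ => antitone_not (A i) h)
    simp only [Finset.prod_insert ha]
    rw [Ex_not, Ex_contains] at hh
    have hp : 0 < p ^ edgeCount K := by positivity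
    have hq : 0 ≤ 1 - p ^ (edgeCount (A a ⊔ K) - edgeCount K) := by
      have := pow_le_one₀ (n := edgeCount (A a ⊔ K) - edgeCount K) h0.le h1
      linarith
    rw [mul_assoc] at hh
    refine le_trans ?_ (le_of_mul_le_mul_left hh hp)
    calc _ = (1 - p ^ (edgeCount (A a ⊔ K) - edgeCount K)) * (p ^ edgeCount K * ∏ i ∈ s, (1 - p ^ (edgeCount (A i ⊔ K) - edgeCount K))) := by ring
      _ ≤ _ := mul_le_mul_of_nonneg_left ih hq

/-- Number of edges of `F` inside `S`. -/
noncomputable def edIn {W : Type*} (F : SimpleGraph W) (S : Set W) : ℕ :=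
  Set.ncard {e ∈ F.edgeSet | ∀ x ∈ e, x ∈ S}

/-- `F` has density `1/α` and no subgraph of larger density. -/
def Bal {W : Type*} (α : ℝ) (F : SimpleGraph W) : Prop :=
  α * edgeCount F = Nat.card W ∧ ∀ S : Set W, α * edIn F S ≤ S.ncard

lemma edgeCount_map {W : Type*} [Finite W] (F : SimpleGraph W) {n : ℕ} (f : W ↪ Fin n) :
    edgeCount (F.map f) = edgeCount F := by
  rw [edgeCount_eq, edgeCount_eq, SimpleGraph.edgeSet_map]
  exact Set.ncard_image_of_injective _ f.sym2Map.injective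

lemma edIn_le {W : Type*} [Finite W] (F : SimpleGraph W) (S : Set W) :
    edIn F S ≤ edgeCount F := by
  rw [edgeCount_eq]
  exact Set.ncard_le_ncard (fun e he => he.1) (Set.toFinite _)

lemma overlap {W U : Type*} [Finite W] [Finite U] (F : SimpleGraph W) (B : SimpleGraph U) {n : ℕ}
    (f : W ↪ Fin n) (g : U ↪ Fin n) :
    edgeCount F + edgeCount (B.map g) ≤
      edgeCount (F.map f ⊔ B.map g) + edIn F {x | f x ∈ Set.range g} := by
  rw [← edgeCount_map F f, ← edgeCount_sup_inf]
  gcongr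
  rw [edgeCount_eq, SimpleGraph.edgeSet_inf, edIn]
  rw [← Set.ncard_image_of_injective _ f.sym2Map.injective]
  refine Set.ncard_le_ncard ?_ (Set.toFinite _)
  rw [SimpleGraph.edgeSet_map, SimpleGraph.edgeSet_map]
  rintro _ ⟨⟨e, he, rfl⟩, ⟨e', he', h⟩⟩
  refine ⟨e, ⟨he, fun x hx => ?_⟩, rfl⟩
  have hx' : f x ∈ f.sym2Map e := by
    rw [Function.Embedding.sym2Map_apply]
    exact Sym2.mem_map.2 ⟨x, hx, rfl⟩
  rw [← h, Function.Embedding.sym2Map_apply] at hx'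
  obtain ⟨y, _, hy⟩ := Sym2.mem_map.1 hx'
  exact ⟨y, hy⟩

lemma overlap_sum {W U : Type*} [Fintype W] [Fintype U] {α : ℝ} (F : SimpleGraph W)
    (hF : Bal α F) (B : SimpleGraph U) {n : ℕ} (hn : 0 < n) (hα : 0 < α)
    (g : U ↪ Fin n) [Fintype (W ↪ Fin n)] :
    ∑ f : W ↪ Fin n, ((n : ℝ) ^ (-α)) ^ (edgeCount (F.map f ⊔ B.map g) - edgeCount (B.map g)) ≤
      ((Fintype.card U : ℝ) + 1) ^ Fintype.card W := by
  classical
  have hn1 : (1 : ℝ) ≤ n := by exact_mod_cast hn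
  have hn0 : (0 : ℝ) < n := by linarith
  let π : (W ↪ Fin n) → (W → Option U) := fun f x =>
    if h : ∃ u, g u = f x then some h.choose else none
  have hπn : ∀ f x, π f x = none ↔ f x ∉ Set.range g := by
    intro f x
    simp only [π]
    split_ifs with h
    · simpa using h
    · simpa using h
  have hπs : ∀ f x u, π f x = some u → f x = g u := by
    intro f x u h
    simp only [π] at h
    split_ifs at h with h'
    rw [← Option.some.inj h, h'.choose_spec]
  rw [← Finset.sum_fiberwise (s := Finset.univ) (g := π)]
  have hcard : ((Fintype.card U : ℝ) + 1) ^ Fintype.card W =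
      ∑ _q : W → Option U, (1 : ℝ) := by
    simp
  rw [hcard]
  refine Finset.sum_le_sum fun q _ => ?_
  set N : Finset W := Finset.univ.filter fun x => q x = none with hN
  have hfib : (Finset.univ.filter fun f => π f = q).card ≤ n ^ N.card := by
    have : Fintype.card (N → Fin n) = n ^ N.card := by simp
    rw [← this, ← Finset.card_univ]
    refine Finset.card_le_card_of_injOn (fun f x => f x) (fun _ _ => Finset.mem_univ _) ?_
    intro f hf f' hf' hff
    simp only [Finset.coe_filter, Finset.mem_univ, true_and, Set.mem_ofPred_eq] at hf hf'
    ext x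
    congr 1
    rcases h : q x with _ | u
    · exact congrFun hff ⟨x, by simp [hN, h]⟩
    · rw [hπs f x u (by rw [hf, h]), hπs f' x u (by rw [hf', h])]
  have hterm : ∀ f ∈ Finset.univ.filter (fun f => π f = q),
      ((n : ℝ) ^ (-α)) ^ (edgeCount (F.map f ⊔ B.map g) - edgeCount (B.map g)) ≤
        ((n : ℝ) ^ N.card)⁻¹ := by
    intro f hf
    simp only [Finset.mem_filter, Finset.mem_univ, true_and] at hf
    have ho := overlap F B f g
    set S : Set W := {x | f x ∈ Set.range g} with hS
    have hSN : S.ncard + N.card = Fintype.card W := by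
      have : S = ((Nᶜ : Finset W) : Set W) := by
        ext x
        have := hπn f x
        rw [hf] at this
        simp only [hS, hN, Set.mem_ofPred_eq, Finset.coe_compl, Finset.coe_filter,
          Finset.mem_univ, true_and, Set.mem_compl_iff, this, not_not]
      rw [this, Set.ncard_coe_finset, Finset.card_compl]
      have := Finset.card_le_univ N
      omega
    have hb := hF.2 S
    have ha := hF.1
    rw [Nat.card_eq_fintype_card] at ha
    have hk : (edgeCount F : ℝ) - edIn F S ≤
        ((edgeCount (F.map f ⊔ B.map g) - edgeCount (B.map g) : ℕ) : ℝ) := by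
      rw [Nat.cast_sub (edgeCount_mono le_sup_right)]
      have : (edgeCount F + edgeCount (B.map g) : ℝ) ≤
        edgeCount (F.map f ⊔ B.map g) + edIn F S := by exact_mod_cast ho
      linarith
    set k := edgeCount (F.map f ⊔ B.map g) - edgeCount (B.map g)
    rw [← Real.rpow_natCast, ← Real.rpow_natCast, ← Real.rpow_mul hn0.le, ← Real.rpow_neg hn0.le]
    apply Real.rpow_le_rpow_of_exponent_le hn1
    have h5 := mul_le_mul_of_nonneg_left hk hα.le
    have h6 : (S.ncard : ℝ) + N.card = Fintype.card W := by exact_mod_cast hSN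
    linarith
  calc _ ≤ ∑ f ∈ Finset.univ.filter (fun f => π f = q), ((n : ℝ) ^ N.card)⁻¹ :=
        Finset.sum_le_sum hterm
    _ = ((Finset.univ.filter fun f => π f = q).card : ℝ) * ((n : ℝ) ^ N.card)⁻¹ := by
        rw [Finset.sum_const, nsmul_eq_mul]
    _ ≤ (n : ℝ) ^ N.card * ((n : ℝ) ^ N.card)⁻¹ := by
        gcongr
        exact_mod_cast hfib
    _ = 1 := mul_inv_cancel₀ (by positivity)

/-- Number of labelled copies of `F` in `Γ`. -/
noncomputable def cnt {W : Type*} [Fintype W] [DecidableEq W] (F : SimpleGraph W) {n : ℕ}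
    (Γ : SimpleGraph (Fin n)) : ℝ := ∑ f : W ↪ Fin n, ind (F.map f ≤ Γ)

lemma pow_edge {W : Type*} [Fintype W] {α : ℝ} {F : SimpleGraph W}
    (hF : Bal α F) {n : ℕ} (hn : 0 < n) :
    ((n : ℝ) ^ (-α)) ^ edgeCount F = ((n : ℝ) ^ Fintype.card W)⁻¹ := by
  have hn0 : (0 : ℝ) < n := by exact_mod_cast hn
  have ha := hF.1
  rw [Nat.card_eq_fintype_card] at ha
  rw [← Real.rpow_natCast, ← Real.rpow_natCast, ← Real.rpow_mul hn0.le, ← Real.rpow_neg hn0.le,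
    ← ha]
  congr 1
  ring

lemma p_pos {α : ℝ} {n : ℕ} (hn : 0 < n) : 0 < (n : ℝ) ^ (-α) :=
  Real.rpow_pos_of_pos (by exact_mod_cast hn) _

lemma p_le {α : ℝ} {n : ℕ} (hα : 0 < α) (hn : 0 < n) : (n : ℝ) ^ (-α) ≤ 1 :=
  Real.rpow_le_one_of_one_le_of_nonpos (by exact_mod_cast hn) (by linarith)

lemma card_emb_le {W : Type*} [Fintype W] [DecidableEq W] (n : ℕ) :
    (Fintype.card (W ↪ Fin n) : ℝ) ≤ (n : ℝ) ^ Fintype.card W := by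
  rw [Fintype.card_embedding_eq, Fintype.card_fin]
  exact_mod_cast Nat.descFactorial_le_pow _ _

lemma card_emb_ge {W : Type*} [Fintype W] [DecidableEq W] {n : ℕ} (h : 2 * Fintype.card W ≤ n) :
    (n : ℝ) ^ Fintype.card W * (1 / 2) ^ Fintype.card W ≤ (Fintype.card (W ↪ Fin n) : ℝ) := by
  rw [Fintype.card_embedding_eq, Fintype.card_fin, ← mul_pow]
  have h1 := Nat.pow_sub_le_descFactorial n (Fintype.card W)
  have h2 : ((n + 1 - Fintype.card W : ℕ) : ℝ) ^ Fintype.card W ≤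
    (n.descFactorial (Fintype.card W) : ℝ) := by exact_mod_cast h1
  refine le_trans (pow_le_pow_left₀ (by positivity) ?_ _) h2
  have h3 : n ≤ 2 * (n + 1 - Fintype.card W) := by omega
  have h4 : (n : ℝ) ≤ 2 * ((n + 1 - Fintype.card W : ℕ) : ℝ) := by exact_mod_cast h3
  linarith

lemma Ex_cnt_le {W : Type*} [Fintype W] [DecidableEq W] {α : ℝ} {F : SimpleGraph W}
    (hF : Bal α F) {n : ℕ} (hn : 0 < n) : Ex n ((n : ℝ) ^ (-α)) (cnt F) ≤ 1 := by
  have hn0 : (0 : ℝ) < n := by exact_mod_cast hn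
  have : Ex n ((n : ℝ) ^ (-α)) (cnt F) = _ := Ex_sum _ _ _ _
  rw [this]
  simp only [Ex_contains, edgeCount_map, pow_edge hF hn, Finset.sum_const, Finset.card_univ,
    nsmul_eq_mul]
  calc _ ≤ (n : ℝ) ^ Fintype.card W * ((n : ℝ) ^ Fintype.card W)⁻¹ := by
        gcongr
        exact card_emb_le n
    _ = 1 := mul_inv_cancel₀ (by positivity)

lemma Ex_cnt_sq {W : Type*} [Fintype W] [DecidableEq W] {α : ℝ} {F : SimpleGraph W} (hα : 0 < α)
    (hF : Bal α F) {n : ℕ} (hn : 0 < n) :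
    Ex n ((n : ℝ) ^ (-α)) (fun Γ => cnt F Γ ^ 2) ≤
      ((Fintype.card W : ℝ) + 1) ^ Fintype.card W := by
  have hn0 : (0 : ℝ) < n := by exact_mod_cast hn
  have h1 : ∀ Γ : SimpleGraph (Fin n), cnt F Γ ^ 2 =
      ∑ g : W ↪ Fin n, ∑ f : W ↪ Fin n, ind (F.map f ⊔ F.map g ≤ Γ) := by
    intro Γ
    rw [sq, cnt, Finset.sum_mul_sum]
    refine Finset.sum_congr rfl fun g _ => Finset.sum_congr rfl fun f _ => ?_
    rw [ind_mul]
    congr 1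
    rw [sup_le_iff, and_comm]
  simp_rw [h1]
  rw [Ex_sum]
  simp_rw [Ex_sum, Ex_contains]
  have h2 : ∀ g f : W ↪ Fin n, ((n : ℝ) ^ (-α)) ^ edgeCount (F.map f ⊔ F.map g) =
      ((n : ℝ) ^ Fintype.card W)⁻¹ *
        ((n : ℝ) ^ (-α)) ^ (edgeCount (F.map f ⊔ F.map g) - edgeCount (F.map g)) := by
    intro g f
    rw [← pow_edge hF hn, ← pow_add]
    congr 1
    have := edgeCount_mono (le_sup_right : F.map g ≤ F.map f ⊔ F.map g)
    rw [edgeCount_map] at *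
    omega
  simp_rw [h2, ← Finset.mul_sum]
  set C := ((Fintype.card W : ℝ) + 1) ^ Fintype.card W with hC
  have hC0 : 0 ≤ C := by positivity
  calc _ ≤ ((n : ℝ) ^ Fintype.card W)⁻¹ * ∑ g : W ↪ Fin n, C := by
        gcongr with g
        exact overlap_sum F hF F hn hα g
    _ = ((n : ℝ) ^ Fintype.card W)⁻¹ * (Fintype.card (W ↪ Fin n) * C) := by simp
    _ ≤ ((n : ℝ) ^ Fintype.card W)⁻¹ * ((n : ℝ) ^ Fintype.card W * C) := by
        gcongr
        exact card_emb_le n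
    _ = C := by field_simp

lemma cnt_eq_zero {W : Type*} [Fintype W] [DecidableEq W] {F : SimpleGraph W} {n : ℕ}
    {Γ : SimpleGraph (Fin n)} (h : ¬∃ f : W ↪ Fin n, F.map f ≤ Γ) : cnt F Γ = 0 :=
  Finset.sum_eq_zero fun f _ => ind_false fun hf => h ⟨f, hf⟩

lemma second_moment {W : Type*} [Fintype W] [DecidableEq W] {α : ℝ} {F : SimpleGraph W}
    (hα : 0 < α) (hF : Bal α F) {n : ℕ} (hn : 0 < n) (Q : SimpleGraph (Fin n) → Prop)
    {L : ℝ} (hL0 : 0 ≤ L) (hL : L ≤ Ex n ((n : ℝ) ^ (-α)) (fun Γ => cnt F Γ * ind (Q Γ))) :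
    L ^ 2 / ((Fintype.card W : ℝ) + 1) ^ Fintype.card W ≤
      Ex n ((n : ℝ) ^ (-α)) (fun Γ => ind ((∃ f : W ↪ Fin n, F.map f ≤ Γ) ∧ Q Γ)) := by
  set p := (n : ℝ) ^ (-α) with hp
  have hw : ∀ Γ : SimpleGraph (Fin n), 0 ≤ weight n p Γ :=
    weight_nonneg (p_pos hn).le (p_le hα hn)
  set C := ((Fintype.card W : ℝ) + 1) ^ Fintype.card W with hC
  have hC0 : 0 < C := by positivity
  rw [div_le_iff₀ hC0]
  have hcs := Finset.sum_mul_sq_le_sq_mul_sq (Finset.univ : Finset (SimpleGraph (Fin n)))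
    (fun Γ => √(weight n p Γ) * ind ((∃ f : W ↪ Fin n, F.map f ≤ Γ) ∧ Q Γ))
    (fun Γ => √(weight n p Γ) * cnt F Γ)
  have e1 : ∑ Γ : SimpleGraph (Fin n),
      √(weight n p Γ) * ind ((∃ f : W ↪ Fin n, F.map f ≤ Γ) ∧ Q Γ) *
        (√(weight n p Γ) * cnt F Γ) = Ex n p (fun Γ => cnt F Γ * ind (Q Γ)) := by
    refine Finset.sum_congr rfl fun Γ _ => ?_
    rw [mul_mul_mul_comm, Real.mul_self_sqrt (hw Γ)]
    congr 1
    by_cases h : ∃ f : W ↪ Fin n, F.map f ≤ Γ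
    · rw [← ind_mul, ind_true h]; ring
    · simp only [cnt_eq_zero h, mul_zero, zero_mul]
  have e2 : ∑ Γ : SimpleGraph (Fin n),
      (√(weight n p Γ) * ind ((∃ f : W ↪ Fin n, F.map f ≤ Γ) ∧ Q Γ)) ^ 2 =
      Ex n p (fun Γ => ind ((∃ f : W ↪ Fin n, F.map f ≤ Γ) ∧ Q Γ)) := by
    refine Finset.sum_congr rfl fun Γ _ => ?_
    rw [mul_pow, Real.sq_sqrt (hw Γ), sq, ind_mul, and_self]
  have e3 : ∑ Γ : SimpleGraph (Fin n), (√(weight n p Γ) * cnt F Γ) ^ 2 =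
      Ex n p (fun Γ => cnt F Γ ^ 2) := by
    refine Finset.sum_congr rfl fun Γ _ => ?_
    rw [mul_pow, Real.sq_sqrt (hw Γ)]
  rw [e1, e2, e3] at hcs
  have h2 : Ex n p (fun Γ => cnt F Γ ^ 2) ≤ C := Ex_cnt_sq hα hF hn
  have h3 : 0 ≤ Ex n p (fun Γ => ind ((∃ f : W ↪ Fin n, F.map f ≤ Γ) ∧ Q Γ)) :=
    Finset.sum_nonneg fun Γ _ => mul_nonneg (hw Γ) (ind_nonneg _)
  calc L ^ 2 ≤ _ := pow_le_pow_left₀ hL0 hL 2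
    _ ≤ _ := hcs
    _ ≤ _ := mul_le_mul_of_nonneg_left h2 h3

/-- Lower bound: a copy of `B` and no copy of `F`. -/
lemma lower_avoid {W U : Type*} [Fintype W] [DecidableEq W] [Fintype U] [DecidableEq U] {α : ℝ}
    (hα : 0 < α) {F : SimpleGraph W} (hF : Bal α F) {B : SimpleGraph U} (hB : Bal α B)
    (hlt : edgeCount B < edgeCount F) :
    ∃ c : ℝ, 0 < c ∧ ∀ n : ℕ, 0 < n → 2 * Fintype.card U ≤ n → (n : ℝ) ^ (-α) ≤ 1 / 2 →
      c ≤ Ex n ((n : ℝ) ^ (-α)) (fun Γ => ind ((∃ f : U ↪ Fin n, B.map f ≤ Γ) ∧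
        ¬∃ f : W ↪ Fin n, F.map f ≤ Γ)) := by
  set C := ((Fintype.card U : ℝ) + 1) ^ Fintype.card W with hC
  set L := (1 / 2 : ℝ) ^ Fintype.card U * Real.exp (-2 * C) with hLdef
  refine ⟨L ^ 2 / ((Fintype.card U : ℝ) + 1) ^ Fintype.card U, by positivity, ?_⟩
  intro n hn hn2 hp2
  have hn0 : (0 : ℝ) < n := by exact_mod_cast hn
  refine second_moment hα hB hn _ (by positivity) ?_
  set p := (n : ℝ) ^ (-α) with hp
  have hp0 : 0 < p := p_pos hn
  have hp1 : p ≤ 1 := p_le hα hn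
  have key : ∀ g : U ↪ Fin n, ((n : ℝ) ^ Fintype.card U)⁻¹ * Real.exp (-2 * C) ≤
      Ex n p (fun Γ => ind (B.map g ≤ Γ) * ind (¬∃ f : W ↪ Fin n, F.map f ≤ Γ)) := by
    intro g
    have h1 := harris_multi hp0 hp1 (B.map g) (Finset.univ : Finset (W ↪ Fin n))
      (fun f => F.map f)
    have h2 : ∀ Γ : SimpleGraph (Fin n), ∏ f : W ↪ Fin n, ind (¬ F.map f ≤ Γ) =
        ind (¬∃ f : W ↪ Fin n, F.map f ≤ Γ) := by
      intro Γ
      by_cases h : ∃ f : W ↪ Fin n, F.map f ≤ Γ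
      · rw [ind_false (not_not.2 h)]
        obtain ⟨f, hf⟩ := h
        exact Finset.prod_eq_zero (Finset.mem_univ f) (ind_false (not_not.2 hf))
      · rw [ind_true h]
        exact Finset.prod_eq_one fun f _ => ind_true fun hf => h ⟨f, hf⟩
    simp_rw [h2] at h1
    refine le_trans ?_ h1
    rw [edgeCount_map, hp, pow_edge hB hn, ← hp]
    gcongr
    have h3 := overlap_sum F hF B hn hα g
    rw [← hp, ← hC] at h3
    calc Real.exp (-2 * C) ≤ Real.exp (-2 * ∑ f : W ↪ Fin n,
          p ^ (edgeCount (F.map f ⊔ B.map g) - edgeCount (B.map g))) := by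
          apply Real.exp_le_exp.2
          linarith
      _ = ∏ f : W ↪ Fin n, Real.exp (-2 *
          p ^ (edgeCount (F.map f ⊔ B.map g) - edgeCount (B.map g))) := by
          rw [Finset.mul_sum, Real.exp_sum]
      _ ≤ ∏ f : W ↪ Fin n, (1 - p ^ (edgeCount (F.map f ⊔ B.map g) - edgeCount (B.map g))) := by
          refine Finset.prod_le_prod (fun _ _ => (Real.exp_pos _).le) fun f _ => ?_
          have h4 : 1 ≤ edgeCount (F.map f ⊔ B.map g) - edgeCount (B.map g) := by
            have := edgeCount_mono (le_sup_left : F.map f ≤ F.map f ⊔ B.map g)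
            rw [edgeCount_map] at *
            omega
          have h5 : p ^ (edgeCount (F.map f ⊔ B.map g) - edgeCount (B.map g)) ≤ 1 / 2 :=
            le_trans (pow_le_of_le_one hp0.le hp1 (by omega)) hp2
          have h6 : 0 ≤ p ^ (edgeCount (F.map f ⊔ B.map g) - edgeCount (B.map g)) := by positivity
          set x := p ^ (edgeCount (F.map f ⊔ B.map g) - edgeCount (B.map g))
          have h7 : 1 + 2 * x ≤ Real.exp (2 * x) := by
            have := Real.add_one_le_exp (2 * x)
            linarith
          have h8 : Real.exp (-2 * x) = (Real.exp (2 * x))⁻¹ := by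
            rw [← Real.exp_neg]; congr 1; ring
          rw [h8]
          apply inv_le_of_inv_le₀ (by linarith)
          refine le_trans ?_ h7
          rw [inv_le_iff_one_le_mul₀ (by linarith)]
          nlinarith
      _ = _ := by simp only [edgeCount_map]
  have hsum : Ex n p (fun Γ => cnt B Γ * ind (¬∃ f : W ↪ Fin n, F.map f ≤ Γ)) =
      ∑ g : U ↪ Fin n, Ex n p (fun Γ => ind (B.map g ≤ Γ) *
        ind (¬∃ f : W ↪ Fin n, F.map f ≤ Γ)) := by
    rw [← Ex_sum]
    simp only [cnt, Finset.sum_mul]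
  rw [hsum]
  calc L = ((n : ℝ) ^ Fintype.card U * (1 / 2) ^ Fintype.card U) *
        (((n : ℝ) ^ Fintype.card U)⁻¹ * Real.exp (-2 * C)) := by
        rw [hLdef]; field_simp
    _ ≤ (Fintype.card (U ↪ Fin n) : ℝ) * (((n : ℝ) ^ Fintype.card U)⁻¹ * Real.exp (-2 * C)) := by
        gcongr
        exact card_emb_ge hn2
    _ = ∑ g : U ↪ Fin n, ((n : ℝ) ^ Fintype.card U)⁻¹ * Real.exp (-2 * C) := by simp
    _ ≤ _ := Finset.sum_le_sum fun g _ => key g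

/-- Lower bound: a copy of `B`. -/
lemma lower_copy {U : Type*} [Fintype U] [DecidableEq U] {α : ℝ}
    (hα : 0 < α) {B : SimpleGraph U} (hB : Bal α B) :
    ∃ c : ℝ, 0 < c ∧ ∀ n : ℕ, 0 < n → 2 * Fintype.card U ≤ n →
      c ≤ Ex n ((n : ℝ) ^ (-α)) (fun Γ => ind (∃ f : U ↪ Fin n, B.map f ≤ Γ)) := by
  refine ⟨((1 / 2 : ℝ) ^ Fintype.card U) ^ 2 / ((Fintype.card U : ℝ) + 1) ^ Fintype.card U,
    by positivity, ?_⟩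
  intro n hn hn2
  have hn0 : (0 : ℝ) < n := by exact_mod_cast hn
  have := second_moment hα hB hn (fun _ => True) (L := (1 / 2 : ℝ) ^ Fintype.card U)
    (by positivity) (by
      simp only [ind_true trivial, mul_one]
      have : Ex n ((n : ℝ) ^ (-α)) (cnt B) = _ := Ex_sum _ _ _ _
      change _ ≤ Ex n ((n : ℝ) ^ (-α)) (cnt B)
      rw [this]
      simp only [Ex_contains, edgeCount_map, pow_edge hB hn, Finset.sum_const, Finset.card_univ,
        nsmul_eq_mul]
      rw [← div_eq_mul_inv, le_div_iff₀ (by positivity), mul_comm]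
      exact card_emb_ge hn2)
  simpa using this

lemma edIn_univ {W : Type*} (F : SimpleGraph W) : edIn F Set.univ = edgeCount F := by
  simp [edIn, edgeCount, Nat.card_coe_set_eq]

/-- Two disjoint copies of `B`. -/
def dbl {U : Type*} (B : SimpleGraph U) : SimpleGraph (U ⊕ U) :=
  B.map (Function.Embedding.inl : U ↪ U ⊕ U) ⊔ B.map (Function.Embedding.inr : U ↪ U ⊕ U)

lemma edIn_dbl {U : Type*} [Finite U] (B : SimpleGraph U) (S : Set (U ⊕ U)) :
    edIn (dbl B) S = edIn B (Sum.inl ⁻¹' S) + edIn B (Sum.inr ⁻¹' S) := by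
  have h : {e ∈ (dbl B).edgeSet | ∀ x ∈ e, x ∈ S} =
      (Function.Embedding.inl : U ↪ U ⊕ U).sym2Map ''
        {e ∈ B.edgeSet | ∀ x ∈ e, x ∈ Sum.inl ⁻¹' S} ∪
      (Function.Embedding.inr : U ↪ U ⊕ U).sym2Map ''
        {e ∈ B.edgeSet | ∀ x ∈ e, x ∈ Sum.inr ⁻¹' S} := by
    ext e
    rw [dbl, SimpleGraph.edgeSet_sup, SimpleGraph.edgeSet_map, SimpleGraph.edgeSet_map]
    constructor
    · rintro ⟨⟨e, he, rfl⟩ | ⟨e, he, rfl⟩, h⟩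
      · refine Or.inl ⟨e, ⟨he, fun x hx => h _ ?_⟩, rfl⟩
        exact Sym2.mem_map.2 ⟨x, hx, rfl⟩
      · refine Or.inr ⟨e, ⟨he, fun x hx => h _ ?_⟩, rfl⟩
        exact Sym2.mem_map.2 ⟨x, hx, rfl⟩
    · rintro (⟨e, ⟨he, h⟩, rfl⟩ | ⟨e, ⟨he, h⟩, rfl⟩)
      · refine ⟨Or.inl ⟨e, he, rfl⟩, fun x hx => ?_⟩
        obtain ⟨y, hy, rfl⟩ := Sym2.mem_map.1 hx
        exact h y hy
      · refine ⟨Or.inr ⟨e, he, rfl⟩, fun x hx => ?_⟩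
        obtain ⟨y, hy, rfl⟩ := Sym2.mem_map.1 hx
        exact h y hy
  rw [edIn, h, Set.ncard_union_eq ?_ (Set.toFinite _) (Set.toFinite _),
    Set.ncard_image_of_injective _ (Function.Embedding.injective _),
    Set.ncard_image_of_injective _ (Function.Embedding.injective _), edIn, edIn]
  rw [Set.disjoint_left]
  rintro _ ⟨e, _, rfl⟩ ⟨e', _, h⟩
  induction e using Sym2.ind with | _ a b =>
  have h1 : (Sum.inl a : U ⊕ U) ∈ (Function.Embedding.inl : U ↪ U ⊕ U).sym2Map s(a, b) :=
    Sym2.mem_map.2 ⟨a, Sym2.mem_mk_left a b, rfl⟩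
  rw [← h] at h1
  obtain ⟨y, _, hy⟩ := Sym2.mem_map.1 h1
  cases hy

lemma Bal_dbl {U : Type*} [Finite U] {B : SimpleGraph U} {α : ℝ} (hB : Bal α B) :
    Bal α (dbl B) := by
  constructor
  · rw [← edIn_univ, edIn_dbl, Set.preimage_univ, Set.preimage_univ, edIn_univ, Nat.card_sum]
    push_cast
    rw [mul_add, hB.1]
  · intro S
    rw [edIn_dbl]
    have h1 := hB.2 (Sum.inl ⁻¹' S)
    have h2 := hB.2 (Sum.inr ⁻¹' S)
    have h3 : (Sum.inl ⁻¹' S).ncard + (Sum.inr ⁻¹' S).ncard = S.ncard := by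
      have hu : S = Sum.inl '' (Sum.inl ⁻¹' S) ∪ Sum.inr '' (Sum.inr ⁻¹' S) := by
        ext x
        constructor
        · intro hx
          rcases x with x | x
          · exact Or.inl ⟨x, hx, rfl⟩
          · exact Or.inr ⟨x, hx, rfl⟩
        · rintro (⟨y, hy, rfl⟩ | ⟨y, hy, rfl⟩)
          · exact hy
          · exact hy
      conv_rhs => rw [hu]
      rw [Set.ncard_union_eq ?_ (Set.toFinite _) (Set.toFinite _),
        Set.ncard_image_of_injective _ Sum.inl_injective,
        Set.ncard_image_of_injective _ Sum.inr_injective]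
      · rw [Set.disjoint_left]
        rintro _ ⟨e, _, rfl⟩ ⟨e', _, h⟩
        cases h
    have h4 : ((Sum.inl ⁻¹' S).ncard : ℝ) + (Sum.inr ⁻¹' S).ncard = S.ncard := by
      exact_mod_cast h3
    push_cast
    linarith

lemma upper_copy {U : Type*} [Fintype U] [DecidableEq U] [Nonempty U] {α : ℝ}
    (hα : 0 < α) {B : SimpleGraph U} (hB : Bal α B) :
    ∃ c : ℝ, 0 < c ∧ ∀ n : ℕ, 0 < n → 2 * Fintype.card (U ⊕ U) ≤ n →
      Ex n ((n : ℝ) ^ (-α)) (fun Γ => ind (∃ f : U ↪ Fin n, B.map f ≤ Γ)) ≤ 1 - c := by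
  obtain ⟨c, hc, h⟩ := lower_copy hα (Bal_dbl hB)
  refine ⟨c, hc, fun n hn hn2 => ?_⟩
  have h1 := h n hn hn2
  have h2 := Ex_cnt_le hB hn
  have h3 : Ex n ((n : ℝ) ^ (-α)) (fun Γ => ind (∃ f : U ↪ Fin n, B.map f ≤ Γ) +
      ind (∃ f : U ⊕ U ↪ Fin n, (dbl B).map f ≤ Γ)) ≤ Ex n ((n : ℝ) ^ (-α)) (cnt B) := by
    refine Ex_mono (p_pos hn).le (p_le hα hn) fun Γ => ?_
    by_cases hd : ∃ f : U ⊕ U ↪ Fin n, (dbl B).map f ≤ Γ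
    · obtain ⟨f, hf⟩ := hd
      have hne : Function.Embedding.inl.trans f ≠ Function.Embedding.inr.trans f := by
        intro he
        obtain ⟨u⟩ := ‹Nonempty U›
        have := DFunLike.congr_fun he u
        have := f.injective this
        cases this
      have e1 : B.map (Function.Embedding.inl.trans f) ≤ Γ := by
        refine le_trans ?_ hf
        rintro a b ⟨_, u, v, huv, rfl, rfl⟩
        exact (SimpleGraph.map_adj ..).2 ⟨_, _, Or.inl ((SimpleGraph.map_adj ..).2 ⟨u, v, huv, rfl, rfl⟩), rfl, rfl⟩
      have e2 : B.map (Function.Embedding.inr.trans f) ≤ Γ := by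
        refine le_trans ?_ hf
        rintro a b ⟨_, u, v, huv, rfl, rfl⟩
        exact (SimpleGraph.map_adj ..).2 ⟨_, _, Or.inr ((SimpleGraph.map_adj ..).2 ⟨u, v, huv, rfl, rfl⟩), rfl, rfl⟩
      have h4 : ∑ g ∈ {Function.Embedding.inl.trans f, Function.Embedding.inr.trans f},
          ind (B.map (g : U ↪ Fin n) ≤ Γ) ≤ cnt B Γ :=
        Finset.sum_le_sum_of_subset_of_nonneg (Finset.subset_univ _)
          fun _ _ _ => ind_nonneg _
      rw [Finset.sum_pair hne, ind_true e1, ind_true e2] at h4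
      have h5 := ind_le_one (∃ f : U ↪ Fin n, B.map f ≤ Γ)
      have h6 := ind_le_one (∃ f : U ⊕ U ↪ Fin n, (dbl B).map f ≤ Γ)
      linarith
    · rw [ind_false hd, add_zero]
      by_cases hb : ∃ f : U ↪ Fin n, B.map f ≤ Γ
      · rw [ind_true hb]
        obtain ⟨f, hf⟩ := hb
        rw [← ind_true hf]
        exact Finset.single_le_sum (f := fun f : U ↪ Fin n => ind (B.map f ≤ Γ))
          (fun _ _ => ind_nonneg _) (Finset.mem_univ f)
      · rw [ind_false hb]
        exact Finset.sum_nonneg fun _ _ => ind_nonneg _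
  have h4 : Ex n ((n : ℝ) ^ (-α)) (fun Γ => ind (∃ f : U ↪ Fin n, B.map f ≤ Γ) +
      ind (∃ f : U ⊕ U ↪ Fin n, (dbl B).map f ≤ Γ)) =
      Ex n ((n : ℝ) ^ (-α)) (fun Γ => ind (∃ f : U ↪ Fin n, B.map f ≤ Γ)) +
      Ex n ((n : ℝ) ^ (-α)) (fun Γ => ind (∃ f : U ⊕ U ↪ Fin n, (dbl B).map f ≤ Γ)) := by
    simp only [Ex, mul_add, Finset.sum_add_distrib]
  linarith

lemma card_coe_edgeSet {V : Type*} {G : SimpleGraph V} (K : G.Subgraph) :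
    Nat.card K.coe.edgeSet = K.edgeSet.ncard := by
  rw [Nat.card_coe_set_eq, ← SimpleGraph.Subgraph.image_coe_edgeSet_coe,
    Set.ncard_image_of_injective _ (Sym2.map.injective Subtype.val_injective)]

lemma induce_edgeSet {V : Type*} (G : SimpleGraph V) (S : Set V) :
    ((⊤ : G.Subgraph).induce S).edgeSet = {e ∈ G.edgeSet | ∀ x ∈ e, x ∈ S} := by
  ext e
  induction e using Sym2.ind with | _ a b =>
  simp [SimpleGraph.Subgraph.mem_edgeSet]
  tauto

lemma Bal_of_strictlyBalanced {U : Type*} [Finite U] {B : SimpleGraph U} {α : ℝ} (hα : 0 < α)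
    (hB : StrictlyBalanced B) (hd : density B = 1 / α) : Bal α B ∧ Nonempty U := by
  have hc : (Nat.card U : ℝ) ≠ 0 := by
    intro h
    rw [density, h, div_zero] at hd
    have : 0 < 1 / α := by positivity
    linarith
  have h1 : α * edgeCount B = Nat.card U := by
    rw [density, div_eq_div_iff hc hα.ne'] at hd
    rw [edgeCount]
    linarith
  refine ⟨⟨h1, fun S => ?_⟩, ?_⟩
  · rcases S.eq_empty_or_nonempty with rfl | hS
    · have : edIn B ∅ = 0 := by
        rw [edIn]
        have : {e ∈ B.edgeSet | ∀ x ∈ e, x ∈ (∅ : Set U)} = ∅ := by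
          ext e
          induction e using Sym2.ind with | _ a b =>
          simp only [Set.mem_ofPred_eq, Set.mem_empty_iff_false, iff_false]
          exact fun h => h.2 a (by simp)
        rw [this, Set.ncard_empty]
      simp [this]
    · by_cases hT : (⊤ : B.Subgraph).induce S = ⊤
      · have : S = Set.univ := by
          have := congrArg SimpleGraph.Subgraph.verts hT
          simpa using this
        rw [this, edIn_univ, h1, Set.ncard_univ]
      · have h2 := hB _ hT hS
        rw [hd, density, card_coe_edgeSet, induce_edgeSet] at h2
        change ((edIn B S : ℕ) : ℝ) / ((S.ncard : ℕ) : ℝ) < _ at h2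
        have h3 : (0 : ℝ) < S.ncard := by
          exact_mod_cast (Set.ncard_pos (Set.toFinite _)).2 hS
        rw [div_lt_div_iff₀ h3 hα] at h2
        linarith
  · by_contra h
    rw [not_nonempty_iff] at h
    simp at hc

lemma Bal_pair {W : Type*} [Finite W] (Gp : SimpleGraph W) (H : Gp.Subgraph) {α : ℝ} (hα : 0 < α)
    (hpair : StrictlyBalancedPair Gp H) (hBH : Bal α H.coe)
    (hρGH : pairDensity (⊤ : Gp.Subgraph) H = 1 / α)
    (hind : ∀ u v, Gp.Adj u v → u ∈ H.verts → v ∈ H.verts → H.Adj u v) :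
    Bal α Gp ∧ edgeCount H.coe < edgeCount Gp := by
  have hHe : (edgeCount H.coe) = H.edgeSet.ncard := card_coe_edgeSet H
  have hHb : α * H.edgeSet.ncard = H.verts.ncard := by
    have := hBH.1
    rwa [hHe] at this
  have hv : H.verts.ncard ≤ Nat.card W := by
    rw [← Set.ncard_univ]
    exact Set.ncard_le_ncard (Set.subset_univ _) (Set.toFinite _)
  have hv' : (H.verts.ncard : ℝ) ≤ Nat.card W := by exact_mod_cast hv
  have hp : pairDensity (⊤ : Gp.Subgraph) H =
      ((edgeCount Gp : ℝ) - H.edgeSet.ncard) / ((Nat.card W : ℝ) - H.verts.ncard) := by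
    rw [pairDensity, SimpleGraph.Subgraph.edgeSet_top, SimpleGraph.Subgraph.verts_top,
      Nat.card_univ, Nat.card_coe_set_eq, Nat.card_coe_set_eq, Nat.card_coe_set_eq]
    rfl
  have hne : (Nat.card W : ℝ) - H.verts.ncard ≠ 0 := by
    intro h
    rw [hp, h, div_zero] at hρGH
    have : 0 < 1 / α := by positivity
    linarith
  have hpos : 0 < (Nat.card W : ℝ) - H.verts.ncard := lt_of_le_of_ne (by linarith) hne.symm
  have htot : α * ((edgeCount Gp : ℝ) - H.edgeSet.ncard) = (Nat.card W : ℝ) - H.verts.ncard := by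
    have h := hρGH
    rw [hp, div_eq_div_iff hne hα.ne'] at h
    linarith
  refine ⟨⟨by linarith, fun S => ?_⟩, ?_⟩
  · have hsub : α * {e ∈ H.edgeSet | ∀ x ∈ e, x ∈ S}.ncard ≤ (S ∩ H.verts).ncard := by
      have h := hBH.2 (Subtype.val ⁻¹' S)
      have e1 : edIn H.coe (Subtype.val ⁻¹' S) = {e ∈ H.edgeSet | ∀ x ∈ e, x ∈ S}.ncard := by
        rw [edIn, ← Set.ncard_image_of_injective _ (Sym2.map.injective
          (Subtype.val_injective (p := (· ∈ H.verts))))]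
        congr 1
        rw [← SimpleGraph.Subgraph.image_coe_edgeSet_coe]
        ext e
        constructor
        · rintro ⟨e, ⟨he, h⟩, rfl⟩
          refine ⟨⟨e, he, rfl⟩, fun x hx => ?_⟩
          obtain ⟨y, hy, rfl⟩ := Sym2.mem_map.1 hx
          exact h y hy
        · rintro ⟨⟨e, he, rfl⟩, h⟩
          exact ⟨e, ⟨he, fun x hx => h _ (Sym2.mem_map.2 ⟨x, hx, rfl⟩)⟩, rfl⟩
      have e2 : (Subtype.val ⁻¹' S : Set H.verts).ncard = (S ∩ H.verts).ncard := by
        rw [← Set.ncard_image_of_injective _ (Subtype.val_injective (p := (· ∈ H.verts)))]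
        congr 1
        ext x
        simp [and_comm]
      rwa [e1, e2] at h
    by_cases hSH : S ⊆ H.verts
    · have e1 : edIn Gp S ≤ {e ∈ H.edgeSet | ∀ x ∈ e, x ∈ S}.ncard := by
        refine Set.ncard_le_ncard ?_ (Set.toFinite _)
        rintro e ⟨he, h⟩
        refine ⟨?_, h⟩
        induction e using Sym2.ind with | _ a b =>
        exact hind a b he (hSH (h a (by simp))) (hSH (h b (by simp)))
      have e2 : (edIn Gp S : ℝ) ≤ {e ∈ H.edgeSet | ∀ x ∈ e, x ∈ S}.ncard := by exact_mod_cast e1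
      rw [Set.inter_eq_left.2 hSH] at hsub
      exact le_trans (mul_le_mul_of_nonneg_left e2 hα.le) hsub
    · set K : Gp.Subgraph := H ⊔ (⊤ : Gp.Subgraph).induce S with hK
      have hKv : K.verts = H.verts ∪ S := by simp [hK]
      have hKe : K.edgeSet = H.edgeSet ∪ {e ∈ Gp.edgeSet | ∀ x ∈ e, x ∈ S} := by
        rw [hK, SimpleGraph.Subgraph.edgeSet_sup, induce_edgeSet]
      have hlt : H < K := by
        refine lt_of_le_of_ne le_sup_left fun h => hSH ?_
        have := congrArg SimpleGraph.Subgraph.verts h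
        rw [hKv] at this
        rw [this]
        exact Set.subset_union_right
      have hle : pairDensity K H ≤ 1 / α := by
        by_cases hT : K = ⊤
        · rw [hT, hρGH]
        · rw [← hρGH]; exact (hpair K hlt hT).le
      have hcv : K.verts.ncard + (S ∩ H.verts).ncard = H.verts.ncard + S.ncard := by
        rw [hKv, Set.inter_comm]
        exact Set.ncard_union_add_ncard_inter _ _ (Set.toFinite _) (Set.toFinite _)
      have hce : K.edgeSet.ncard + {e ∈ H.edgeSet | ∀ x ∈ e, x ∈ S}.ncard =
          H.edgeSet.ncard + edIn Gp S := by
        have hi : {e ∈ H.edgeSet | ∀ x ∈ e, x ∈ S} =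
            H.edgeSet ∩ {e ∈ Gp.edgeSet | ∀ x ∈ e, x ∈ S} := by
          ext e
          constructor
          · rintro ⟨h1, h2⟩
            exact ⟨h1, SimpleGraph.Subgraph.edgeSet_subset H h1, h2⟩
          · rintro ⟨h1, _, h2⟩
            exact ⟨h1, h2⟩
        rw [hKe, edIn, hi]
        exact Set.ncard_union_add_ncard_inter _ _ (Set.toFinite _) (Set.toFinite _)
      have hltv : H.verts.ncard < K.verts.ncard := by
        refine Set.ncard_lt_ncard ?_ (Set.toFinite _)
        rw [hKv]
        refine ⟨Set.subset_union_left, fun h => hSH ?_⟩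
        exact Set.subset_union_right.trans h
      have hcv' : (K.verts.ncard : ℝ) + (S ∩ H.verts).ncard = H.verts.ncard + S.ncard := by
        exact_mod_cast hcv
      have hce' : (K.edgeSet.ncard : ℝ) + {e ∈ H.edgeSet | ∀ x ∈ e, x ∈ S}.ncard =
          H.edgeSet.ncard + edIn Gp S := by exact_mod_cast hce
      have hltv' : (0 : ℝ) < K.verts.ncard - H.verts.ncard := by
        have : (H.verts.ncard : ℝ) < K.verts.ncard := by exact_mod_cast hltv
        linarith
      rw [pairDensity] at hle
      simp only [Nat.card_coe_set_eq] at hle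
      rw [div_le_div_iff₀ hltv' hα] at hle
      have : (edIn Gp S : ℝ) = (K.edgeSet.ncard - H.edgeSet.ncard) +
        {e ∈ H.edgeSet | ∀ x ∈ e, x ∈ S}.ncard := by linarith
      rw [this]
      linarith
  · rw [hHe]
    have : 0 < α * ((edgeCount Gp : ℝ) - H.edgeSet.ncard) := by rw [htot]; exact hpos
    have := pos_of_mul_pos_right this hα.le
    have : (H.edgeSet.ncard : ℝ) < edgeCount Gp := by linarith
    exact_mod_cast this

lemma containsCopy_iff {W : Type*} (F : SimpleGraph W) {n : ℕ} (Γ : SimpleGraph (Fin n)) :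
    ContainsCopy F Γ ↔ ∃ f : W ↪ Fin n, F.map f ≤ Γ := by
  constructor
  · rintro ⟨f, hf, h⟩
    refine ⟨⟨f, hf⟩, ?_⟩
    rw [SimpleGraph.map_le_iff_le_comap]
    exact fun u v huv => h u v huv
  · rintro ⟨f, hf⟩
    rw [SimpleGraph.map_le_iff_le_comap] at hf
    exact ⟨f, f.injective, fun u v huv => hf huv⟩

lemma subseq_of_bounds (a : ℕ → ℝ) (c1 c2 : ℝ) (h1 : 0 < c1) (h2 : c2 < 1)
    (h : ∀ᶠ n in atTop, c1 ≤ a n ∧ a n ≤ c2) :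
    ∃ ns : ℕ → ℕ, StrictMono ns ∧ (∀ i, 0 < ns i) ∧ ∃ c : ℝ, 0 < c ∧ c < 1 ∧
      Tendsto (fun i => a (ns i)) atTop (nhds c) := by
  obtain ⟨N, hN⟩ := eventually_atTop.1 h
  obtain ⟨c, hc, φ, hφ, hlim⟩ := (isCompact_Icc (a := c1) (b := c2)).tendsto_subseq
    (x := fun n => a (n + (N + 1))) (fun n => hN _ (by omega))
  refine ⟨fun i => φ i + (N + 1), fun i j hij => ?_, fun i => by positivity, c,
    lt_of_lt_of_le h1 hc.1, lt_of_le_of_lt hc.2 h2, hlim⟩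
  have := hφ hij
  simp only
  omega

/-- Lemma on the existence of a copy of a strictly balanced graph without extensions:
along a subsequence, with asymptotic probability strictly between 0 and 1, `G(n, n^{-α})`
contains a copy of `H` and every ordered `v`-tuple `w` either fails `A_w` or has no
`(G,(h_1,…,h_v))`-extension. -/
theorem copy_without_extension_along_subsequence {W : Type*} [Fintype W]
    (Gp : SimpleGraph W) (H : Gp.Subgraph) {v : ℕ} (r : Fin v → W)
    (hr : Function.Injective r) (hrange : Set.range r = H.verts)
    (hproper : H ≠ ⊤)
    (hH : StrictlyBalanced H.coe) (hpair : StrictlyBalancedPair Gp H)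
    (α : ℝ) (hα : 0 < α)
    (hρH : density H.coe = 1 / α)
    (hρGH : pairDensity (⊤ : Gp.Subgraph) H = 1 / α) :
    ∃ ns : ℕ → ℕ, StrictMono ns ∧ (∀ i, 0 < ns i) ∧ ∃ c : ℝ, 0 < c ∧ c < 1 ∧
      Tendsto (fun i : ℕ => probPred (ns i) (((ns i : ℝ)) ^ (-α)) (fun Γ =>
          ContainsCopy H.coe Γ ∧
          ∀ w : Fin v → Fin (ns i), Function.Injective w →
            (¬∀ j j' : Fin v, H.Adj (r j) (r j') → Γ.Adj (w j) (w j')) ∨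
            ¬∃ f : W → Fin (ns i), IsExtension Gp H r Γ w f))
        atTop (nhds c) := by
  classical
  obtain ⟨hBH, hUne⟩ := Bal_of_strictlyBalanced hα hH hρH
  have hpt : Tendsto (fun n : ℕ => (n : ℝ) ^ (-α)) atTop (nhds 0) :=
    (tendsto_rpow_neg_atTop hα).comp tendsto_natCast_atTop_atTop
  have hphalf : ∀ᶠ n : ℕ in atTop, (n : ℝ) ^ (-α) ≤ 1 / 2 :=
    (hpt.eventually (gt_mem_nhds (by norm_num : (0 : ℝ) < 1 / 2))).mono fun n hn => le_of_lt hn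
  -- lower bound
  have hlow : ∃ c1 : ℝ, 0 < c1 ∧ ∀ᶠ n : ℕ in atTop, c1 ≤ probPred n ((n : ℝ) ^ (-α)) (fun Γ =>
          ContainsCopy H.coe Γ ∧
          ∀ w : Fin v → Fin n, Function.Injective w →
            (¬∀ j j' : Fin v, H.Adj (r j) (r j') → Γ.Adj (w j) (w j')) ∨
            ¬∃ f : W → Fin n, IsExtension Gp H r Γ w f) := by
    by_cases hind : ∀ u v, Gp.Adj u v → u ∈ H.verts → v ∈ H.verts → H.Adj u v
    · obtain ⟨hBG, hlt⟩ := Bal_pair Gp H hα hpair hBH hρGH hind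
      obtain ⟨c, hc, h⟩ := lower_avoid hα hBG hBH hlt
      refine ⟨c, hc, ?_⟩
      filter_upwards [hphalf, eventually_gt_atTop 0,
        eventually_ge_atTop (2 * Fintype.card H.verts)] with n hp hn hn2
      refine (h n hn hn2 hp).trans ?_
      rw [probPred_eq]
      refine Ex_mono (p_pos hn).le (p_le hα hn) fun Γ => ind_mono ?_
      rintro ⟨h1, h2⟩
      refine ⟨(containsCopy_iff _ _).2 h1, fun w _ => ?_⟩
      by_contra hcon
      rw [not_or, not_not, not_not] at hcon
      obtain ⟨hA, f, hf, hfr, hfe⟩ := hcon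
      refine h2 ⟨⟨f, hf⟩, ?_⟩
      rw [SimpleGraph.map_le_iff_le_comap]
      intro a b hab
      change Γ.Adj (f a) (f b)
      by_cases hHab : H.Adj a b
      · have ha : a ∈ Set.range r := hrange ▸ H.edge_vert hHab
        have hb : b ∈ Set.range r := hrange ▸ H.edge_vert hHab.symm
        obtain ⟨j, rfl⟩ := ha
        obtain ⟨j', rfl⟩ := hb
        rw [hfr, hfr]
        exact hA j j' hHab
      · exact (hfe a b hab hHab).1
    · obtain ⟨c, hc, h⟩ := lower_copy hα hBH
      refine ⟨c, hc, ?_⟩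
      filter_upwards [eventually_gt_atTop 0,
        eventually_ge_atTop (2 * Fintype.card H.verts)] with n hn hn2
      refine (h n hn hn2).trans ?_
      rw [probPred_eq]
      refine Ex_mono (p_pos hn).le (p_le hα hn) fun Γ => ind_mono ?_
      intro h1
      refine ⟨(containsCopy_iff _ _).2 h1, fun w _ => Or.inr ?_⟩
      rintro ⟨f, -, -, hfe⟩
      refine hind fun a b hab ha hb => ?_
      by_contra hHab
      exact (hfe a b hab hHab).2 ⟨ha, hb⟩
  obtain ⟨c1, hc1, hl⟩ := hlow
  obtain ⟨c2, hc2, hu⟩ := upper_copy hα hBH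
  refine subseq_of_bounds (fun n => probPred n ((n : ℝ) ^ (-α)) (fun Γ =>
          ContainsCopy H.coe Γ ∧
          ∀ w : Fin v → Fin n, Function.Injective w →
            (¬∀ j j' : Fin v, H.Adj (r j) (r j') → Γ.Adj (w j) (w j')) ∨
            ¬∃ f : W → Fin n, IsExtension Gp H r Γ w f)) c1 (1 - c2) hc1 (by linarith) ?_
  filter_upwards [hl, eventually_gt_atTop 0,
    eventually_ge_atTop (2 * Fintype.card (H.verts ⊕ H.verts))] with n h1 hn hn2
  refine ⟨h1, le_trans ?_ (hu n hn hn2)⟩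
  rw [probPred_eq]
  exact Ex_mono (p_pos hn).le (p_le hα hn) fun Γ =>
    ind_mono fun h => (containsCopy_iff _ _).1 h.1

end RandomGraphSpectra
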